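/- Suppose W : ℝ^d → (0,∞) is measurable and satisfies c₁(1 + |x|)^β ≤ W(x) ≤ c₂·exp( c₃(1 + |x|)^{(β−α)/δ} ) for all x ∈ ℝ^d, with constants β > α, δ > 1 and c₁, c₂, c₃ > 0. For each integer n ≥ 1, define λ_n = inf{ sup_{f ∈ F, f ≠ 0} D(f,f) / ∫_{ℝ^d} f² dμ : F an n-dimensional linear subspace of C_c^∞(ℝ^d) }. Then there exists a constant c ≥ 1 such that for all n ≥ 1: c^{-1}·n^{α/d} ≤ λ_n ≤ c·n^{α/d}. -/

import Mathlib

open MeasureTheory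

/-- The fractional Dirichlet energy
`D(f,f) = ∫∫ (f(x) − f(y))² / |x − y|^{d+α} dx dy` on `ℝ^d`. -/
noncomputable def fracD (d : ℕ) (α : ℝ) (f : EuclideanSpace ℝ (Fin d) → ℝ) : ℝ :=
  ∫ x, ∫ y, (f x - f y) ^ 2 / ‖x - y‖ ^ ((d : ℝ) + α)

/-- The Courant–Fischer min–max level
`λ_n = inf { sup_{0 ≠ f ∈ F} D(f,f)/∫ f² dμ : F ⊆ C_c^∞(ℝ^d), dim F = n }`,
where `μ(dx) = W(x)⁻¹ dx`. -/
noncomputable def minMaxLevel (d : ℕ) (α : ℝ) (W : EuclideanSpace ℝ (Fin d) → ℝ)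
    (n : ℕ) : ℝ :=
  sInf { Λ : ℝ | ∃ F : Submodule ℝ (EuclideanSpace ℝ (Fin d) → ℝ),
    Module.finrank ℝ F = n ∧
    (∀ f ∈ F, ContDiff ℝ (⊤ : ℕ∞) f ∧ HasCompactSupport f) ∧
    Λ = sSup { t : ℝ | ∃ f ∈ F, f ≠ 0 ∧
          t = fracD d α f / ∫ x, (f x) ^ 2 * (W x)⁻¹ } }


noncomputable def kerD (d : ℕ) (α : ℝ) (f : EuclideanSpace ℝ (Fin d) → ℝ)
    (p : EuclideanSpace ℝ (Fin d) × EuclideanSpace ℝ (Fin d)) : ℝ :=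
  (f p.1 - f p.2) ^ 2 / ‖p.1 - p.2‖ ^ ((d : ℝ) + α)

lemma kerD_nonneg (d : ℕ) (α : ℝ) (f : EuclideanSpace ℝ (Fin d) → ℝ) (p) :
    0 ≤ kerD d α f p := by
  unfold kerD; positivity

lemma kernel_integrable (d : ℕ) (α : ℝ) (hα : α ∈ Set.Ioo (0 : ℝ) 2) (hd : 1 ≤ d) :
    Integrable (fun z : EuclideanSpace ℝ (Fin d) =>
      min (‖z‖ ^ 2) 1 / ‖z‖ ^ ((d : ℝ) + α)) := by
  have : Nonempty (Fin d) := ⟨⟨0, hd⟩⟩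
  have : Nontrivial (EuclideanSpace ℝ (Fin d)) := inferInstance
  refine (integrable_fun_norm_addHaar (volume : Measure (EuclideanSpace ℝ (Fin d)))
    (f := fun r : ℝ => min (r ^ 2) 1 / r ^ ((d : ℝ) + α))).mpr ?_
  have hm : Measurable (fun y : ℝ ↦ y ^ (Module.finrank ℝ (EuclideanSpace ℝ (Fin d)) - 1) •
      (min (y ^ 2) 1 / y ^ ((d : ℝ) + α))) := by fun_prop
  rw [← Set.Ioc_union_Ioi_eq_Ioi (zero_le_one (α := ℝ))]
  have key : ∀ y : ℝ, 0 < y → y ^ (Module.finrank ℝ (EuclideanSpace ℝ (Fin d)) - 1) •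
      (min (y ^ 2) 1 / y ^ ((d : ℝ) + α)) = min (y^2) 1 * y ^ (-1 - α) := by
    intro y hy
    rw [finrank_euclideanSpace_fin, smul_eq_mul, ← Real.rpow_natCast, Nat.cast_sub hd,
      mul_div_assoc', mul_comm, mul_div_assoc, ← Real.rpow_sub hy]
    congr 2
    push_cast
    ring
  refine IntegrableOn.union ?_ ?_
  · have h := (intervalIntegral.intervalIntegrable_rpow' (a := 0) (b := 1) (r := 1 - α)
      (by linarith [hα.2])).1
    refine Integrable.mono' h hm.aestronglyMeasurable ?_
    refine (ae_restrict_mem measurableSet_Ioc).mono fun y hy => ?_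
    rw [key y hy.1, Real.norm_of_nonneg (mul_nonneg (by positivity) (Real.rpow_nonneg hy.1.le _))]
    calc min (y^2) 1 * y ^ (-1 - α) ≤ y ^ 2 * y ^ (-1 - α) := by
          gcongr
          · exact Real.rpow_nonneg hy.1.le _
          · exact min_le_left _ _
      _ = y ^ (1 - α) := by
          rw [← Real.rpow_natCast, ← Real.rpow_add hy.1]; congr 1; push_cast; ring
  · have h := integrableOn_Ioi_rpow_of_lt (a := -1 - α) (by linarith [hα.1]) zero_lt_one
    refine Integrable.mono' h hm.aestronglyMeasurable ?_
    refine (ae_restrict_mem measurableSet_Ioi).mono fun y hy => ?_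
    have hy0 : 0 < y := lt_trans zero_lt_one hy
    rw [key y hy0, Real.norm_of_nonneg (mul_nonneg (by positivity) (Real.rpow_nonneg hy0.le _))]
    calc min (y^2) 1 * y ^ (-1 - α) ≤ 1 * y ^ (-1 - α) := by
          gcongr
          exact min_le_right _ _
      _ = _ := one_mul _

lemma diff_sq_bound (d : ℕ) (f : EuclideanSpace ℝ (Fin d) → ℝ)
    (hf : ContDiff ℝ (⊤ : ℕ∞) f) (hc : HasCompactSupport f) :
    ∃ C : ℝ, 0 ≤ C ∧ ∀ x y, (f x - f y) ^ 2 ≤ C * min (‖x - y‖ ^ 2) 1 := by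
  obtain ⟨L, hL⟩ := ContDiff.lipschitzWith_of_hasCompactSupport hc hf (by simp)
  obtain ⟨M, hM⟩ := hc.exists_bound_of_continuous hf.continuous
  refine ⟨max ((L:ℝ)^2) ((2*M)^2), by positivity, fun x y => ?_⟩
  have h1 : |f x - f y| ≤ L * ‖x - y‖ := by
    have := hL.dist_le_mul x y
    rwa [Real.dist_eq, dist_eq_norm] at this
  have h2 : |f x - f y| ≤ 2 * M := by
    have := hM x; have := hM y
    calc |f x - f y| ≤ |f x| + |f y| := abs_sub _ _
      _ ≤ 2 * M := by simp only [Real.norm_eq_abs] at *; linarith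
  rw [← sq_abs]
  rcases le_total (‖x - y‖ ^ 2) 1 with h | h
  · rw [min_eq_left h]
    calc |f x - f y| ^ 2 ≤ (L * ‖x - y‖) ^ 2 := by gcongr
      _ = L ^ 2 * ‖x - y‖ ^ 2 := by ring
      _ ≤ _ := by gcongr; exact le_max_left _ _
  · rw [min_eq_right h, mul_one]
    exact le_trans (by gcongr) (le_max_right _ _)

lemma kerD_measurable (d : ℕ) (α : ℝ) (f : EuclideanSpace ℝ (Fin d) → ℝ)
    (hf : Continuous f) : Measurable (kerD d α f) := by
  unfold kerD
  have := hf.measurable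
  fun_prop

lemma kerD_le {d : ℕ} {α : ℝ} {f : EuclideanSpace ℝ (Fin d) → ℝ} {C : ℝ}
    (hC : ∀ x y, (f x - f y) ^ 2 ≤ C * min (‖x - y‖ ^ 2) 1)
    (x y : EuclideanSpace ℝ (Fin d)) :
    kerD d α f (x, y) ≤ C * (min (‖x - y‖ ^ 2) 1 / ‖x - y‖ ^ ((d : ℝ) + α)) := by
  unfold kerD
  rw [mul_div_assoc']
  have := hC x y
  gcongr

lemma kerD_integrable_right (d : ℕ) (α : ℝ) (hα : α ∈ Set.Ioo (0 : ℝ) 2) (hd : 1 ≤ d)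
    (f : EuclideanSpace ℝ (Fin d) → ℝ)
    (hf : ContDiff ℝ (⊤ : ℕ∞) f) (hc : HasCompactSupport f) (x : EuclideanSpace ℝ (Fin d)) :
    Integrable (fun y => kerD d α f (x, y)) := by
  obtain ⟨C, hC0, hC⟩ := diff_sq_bound d f hf hc
  have hk := ((kernel_integrable d α hα hd).comp_sub_left x).const_mul C
  refine hk.mono' ((kerD_measurable d α f hf.continuous).comp
    measurable_prodMk_left).aestronglyMeasurable (Filter.Eventually.of_forall fun y => ?_)
  rw [Real.norm_of_nonneg (kerD_nonneg ..)]
  exact kerD_le hC x y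

lemma kerD_integrable (d : ℕ) (α : ℝ) (hα : α ∈ Set.Ioo (0 : ℝ) 2) (hd : 1 ≤ d)
    (f : EuclideanSpace ℝ (Fin d) → ℝ)
    (hf : ContDiff ℝ (⊤ : ℕ∞) f) (hc : HasCompactSupport f) :
    Integrable (kerD d α f) (volume.prod volume) := by
  obtain ⟨C, hC0, hC⟩ := diff_sq_bound d f hf hc
  set g : EuclideanSpace ℝ (Fin d) → ℝ := (tsupport f).indicator (fun _ => (1:ℝ)) with hg
  have hgi : Integrable g := by
    rw [hg, integrable_indicator_iff (isClosed_tsupport f).measurableSet]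
    exact integrableOn_const (hc.isCompact.measure_lt_top.ne)
  have h1 := (hgi.convolution_integrand (ContinuousLinearMap.mul ℝ ℝ)
    (kernel_integrable d α hα hd))
  have h2 := h1.swap
  refine ((h1.add h2).const_mul C).mono'
    (kerD_measurable d α f hf.continuous).aestronglyMeasurable
    (Filter.Eventually.of_forall fun ⟨x, y⟩ => ?_)
  rw [Real.norm_of_nonneg (kerD_nonneg ..)]
  have hb := kerD_le (α := α) hC x y
  set k := (min (‖x - y‖ ^ 2) 1 / ‖x - y‖ ^ ((d : ℝ) + α)) with hk
  have hk' : (min (‖y - x‖ ^ 2) 1 / ‖y - x‖ ^ ((d : ℝ) + α)) = k := by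
    rw [hk, norm_sub_rev]
  have hk0 : 0 ≤ k := by positivity
  simp only [Pi.add_apply, Function.comp, Prod.swap, ContinuousLinearMap.mul_apply', hk', ← hk]
  have gx : ∀ z, 0 ≤ g z := fun z => Set.indicator_nonneg (fun _ _ => zero_le_one) z
  by_cases hx : x ∈ tsupport f
  · have : g x = 1 := Set.indicator_of_mem hx _
    rw [this]
    refine hb.trans ?_
    have := gx y
    gcongr
    nlinarith
  · by_cases hy : y ∈ tsupport f
    · have : g y = 1 := Set.indicator_of_mem hy _
      rw [this]
      refine hb.trans ?_
      have := gx x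
      gcongr
      nlinarith
    · have : kerD d α f (x, y) = 0 := by
        simp [kerD, image_eq_zero_of_notMem_tsupport hx, image_eq_zero_of_notMem_tsupport hy]
      rw [this]
      have := gx x
      have := gx y
      positivity

lemma fracD_eq_prod (d : ℕ) (α : ℝ) (hα : α ∈ Set.Ioo (0 : ℝ) 2) (hd : 1 ≤ d)
    (f : EuclideanSpace ℝ (Fin d) → ℝ)
    (hf : ContDiff ℝ (⊤ : ℕ∞) f) (hc : HasCompactSupport f) :
    fracD d α f = ∫ p, kerD d α f p ∂(volume.prod volume) := by
  rw [integral_prod _ (kerD_integrable d α hα hd f hf hc)]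
  rfl

lemma fracD_eq (d : ℕ) (α : ℝ) (f : EuclideanSpace ℝ (Fin d) → ℝ) :
    fracD d α f = ∫ x, ∫ y, kerD d α f (x, y) := rfl

lemma fracD_nonneg (d : ℕ) (α : ℝ) (f : EuclideanSpace ℝ (Fin d) → ℝ) :
    0 ≤ fracD d α f :=
  integral_nonneg fun x => integral_nonneg fun y => kerD_nonneg d α f (x, y)


def cubeSet (d : ℕ) (a : Fin d → ℝ) (l : ℝ) : Set (EuclideanSpace ℝ (Fin d)) :=
  {x | ∀ i, a i ≤ x i ∧ x i < a i + l}

lemma cubeSet_eq (d : ℕ) (a : Fin d → ℝ) (l : ℝ) : cubeSet d a l =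
    (@WithLp.ofLp 2 (Fin d → ℝ)) ⁻¹' (Set.univ.pi fun i => Set.Ico (a i) (a i + l)) := by
  ext x; simp [cubeSet]

lemma cubeSet_measurable (d : ℕ) (a : Fin d → ℝ) (l : ℝ) : MeasurableSet (cubeSet d a l) := by
  rw [cubeSet_eq]
  exact (PiLp.volume_preserving_ofLp (Fin d)).measurable
    (MeasurableSet.univ_pi fun i => measurableSet_Ico)

lemma cubeSet_volume (d : ℕ) (a : Fin d → ℝ) (l : ℝ) :
    volume (cubeSet d a l) = ENNReal.ofReal l ^ d := by
  rw [cubeSet_eq, (PiLp.volume_preserving_ofLp (Fin d)).measure_preimage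
    (MeasurableSet.univ_pi fun i => measurableSet_Ico).nullMeasurableSet, Real.volume_pi_Ico]
  simp

lemma cubeSet_volume_real (d : ℕ) (a : Fin d → ℝ) (l : ℝ) (hl : 0 ≤ l) :
    volume.real (cubeSet d a l) = l ^ d := by
  rw [Measure.real, cubeSet_volume, ENNReal.toReal_pow, ENNReal.toReal_ofReal hl]

lemma cubeSet_dist (d : ℕ) (a : Fin d → ℝ) (l : ℝ) (hl : 0 ≤ l) (x y)
    (hx : x ∈ cubeSet d a l) (hy : y ∈ cubeSet d a l) : ‖x - y‖ ≤ d * l := by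
  rw [EuclideanSpace.norm_eq]
  apply Real.sqrt_le_iff.mpr
  refine ⟨by positivity, ?_⟩
  calc ∑ i, ‖(x - y) i‖ ^ 2 ≤ ∑ i : Fin d, l ^ 2 := by
        apply Finset.sum_le_sum
        intro i _
        have := hx i; have := hy i
        have : |x i - y i| ≤ l := by rw [abs_le]; constructor <;> linarith
        simp only [PiLp.sub_apply, Real.norm_eq_abs]
        gcongr
    _ = d * l ^ 2 := by simp
    _ ≤ (d:ℝ) * d * l ^ 2 := by
        have : (d:ℝ) ≤ d * d := by exact_mod_cast Nat.le_mul_self d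
        gcongr
    _ = _ := by ring

lemma cube_ptwise (d : ℕ) (α : ℝ) (hα : α ∈ Set.Ioo (0 : ℝ) 2) (hd : 1 ≤ d)
    (f : EuclideanSpace ℝ (Fin d) → ℝ)
    (hf : ContDiff ℝ (⊤ : ℕ∞) f) (hc : HasCompactSupport f)
    (a : Fin d → ℝ) (l : ℝ) (hl : 0 ≤ l) (x) (hx : x ∈ cubeSet d a l) :
    ∫ y in cubeSet d a l, (f x - f y) ^ 2 ≤
      (d * l) ^ ((d:ℝ) + α) * ∫ y, kerD d α f (x, y) := by
  have hi := kerD_integrable_right d α hα hd f hf hc x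
  have hfin : volume (cubeSet d a l) < ⊤ := by
    rw [cubeSet_volume]; exact ENNReal.pow_lt_top ENNReal.ofReal_lt_top
  calc ∫ y in cubeSet d a l, (f x - f y) ^ 2
      ≤ ∫ y in cubeSet d a l, (d * l) ^ ((d:ℝ) + α) * kerD d α f (x, y) := by
        apply integral_mono_of_nonneg
        · exact Filter.Eventually.of_forall fun y => sq_nonneg _
        · exact (hi.const_mul _).integrableOn
        · refine (ae_restrict_mem (cubeSet_measurable d a l)).mono fun y hy => ?_
          have hdist := cubeSet_dist d a l hl x y hx hy
          have he : 0 < (d:ℝ) + α := by have := hα.1; positivity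
          rcases eq_or_ne x y with h | h
          · subst h
            simp [kerD]
          · have hpos : 0 < ‖x - y‖ := norm_pos_iff.mpr (sub_ne_zero.mpr h)
            have hp : 0 < ‖x - y‖ ^ ((d:ℝ) + α) := Real.rpow_pos_of_pos hpos _
            dsimp only [kerD]
            rw [mul_div_assoc', le_div_iff₀ hp, mul_comm]
            gcongr
    _ = (d * l) ^ ((d:ℝ) + α) * ∫ y in cubeSet d a l, kerD d α f (x, y) :=
        integral_const_mul _ _
    _ ≤ _ := by
        refine mul_le_mul_of_nonneg_left ?_ (by positivity)
        exact setIntegral_le_integral hi (Filter.Eventually.of_forall fun y => kerD_nonneg ..)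

lemma cc_sq_integrable (d : ℕ) (f g : EuclideanSpace ℝ (Fin d) → ℝ)
    (hf : Continuous f) (hg : Continuous g) (hc : HasCompactSupport f) :
    Integrable (fun y => f y * g y) :=
  (hf.mul hg).integrable_of_hasCompactSupport hc.mul_right

lemma G_integrable (d : ℕ) (α : ℝ) (hα : α ∈ Set.Ioo (0 : ℝ) 2) (hd : 1 ≤ d)
    (f : EuclideanSpace ℝ (Fin d) → ℝ)
    (hf : ContDiff ℝ (⊤ : ℕ∞) f) (hc : HasCompactSupport f) :
    Integrable (fun x => ∫ y, kerD d α f (x, y)) :=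
  (kerD_integrable d α hα hd f hf hc).integral_prod_left

/-- pointwise Poincare for mean zero functions -/
lemma cube_meanzero (d : ℕ) (α : ℝ) (hα : α ∈ Set.Ioo (0 : ℝ) 2) (hd : 1 ≤ d)
    (f : EuclideanSpace ℝ (Fin d) → ℝ)
    (hf : ContDiff ℝ (⊤ : ℕ∞) f) (hc : HasCompactSupport f)
    (a : Fin d → ℝ) (l : ℝ) (hl : 0 < l) (x) (hx : x ∈ cubeSet d a l)
    (h0 : ∫ y in cubeSet d a l, f y = 0) :
    f x ^ 2 ≤ (d:ℝ) ^ ((d:ℝ) + α) * l ^ α * ∫ y, kerD d α f (x, y) := by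
  have h := cube_ptwise d α hα hd f hf hc a l hl.le x hx
  have hfi : Integrable f := hf.continuous.integrable_of_hasCompactSupport hc
  have hf2 : Integrable (fun y => f y ^ 2) := by
    simpa [sq] using cc_sq_integrable d f f hf.continuous hf.continuous hc
  have hfin : volume (cubeSet d a l) < ⊤ := by
    rw [cubeSet_volume]; exact ENNReal.pow_lt_top ENNReal.ofReal_lt_top
  have e : ∫ y in cubeSet d a l, (f x - f y) ^ 2 =
      l ^ d * f x ^ 2 + ∫ y in cubeSet d a l, f y ^ 2 := by
    have : (fun y => (f x - f y) ^ 2) = fun y => (f x ^ 2 - 2 * f x * f y) + f y ^ 2 := by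
      ext y; ring
    rw [this, integral_add, integral_sub, integral_const_mul, h0, setIntegral_const,
      cubeSet_volume_real d a l hl.le]
    · simp
    · exact integrableOn_const hfin.ne
    · exact (hfi.const_mul _).integrableOn
    · exact Integrable.sub (integrableOn_const hfin.ne) (hfi.const_mul _).integrableOn
    · exact hf2.integrableOn
  have hnn : 0 ≤ ∫ y in cubeSet d a l, f y ^ 2 := integral_nonneg fun y => sq_nonneg _
  have hl' : 0 < l ^ d := by positivity
  rw [Real.mul_rpow (by positivity) hl.le, Real.rpow_add hl, Real.rpow_natCast] at h
  have h3 : l ^ d * f x ^ 2 ≤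
      l ^ d * ((d:ℝ) ^ ((d:ℝ) + α) * l ^ α * ∫ y, kerD d α f (x, y)) := by
    nlinarith
  exact le_of_mul_le_mul_left h3 hl'

def boxSet (d : ℕ) (R : ℝ) : Set (EuclideanSpace ℝ (Fin d)) := cubeSet d (fun _ => -R) (2 * R)

lemma boxSet_mono (d : ℕ) {R S : ℝ} (h : R ≤ S) : boxSet d R ⊆ boxSet d S := by
  intro x hx i
  have := hx i
  simp only at *
  constructor <;> linarith

lemma box_step (d : ℕ) (α : ℝ) (hα : α ∈ Set.Ioo (0 : ℝ) 2) (hd : 1 ≤ d)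
    (f : EuclideanSpace ℝ (Fin d) → ℝ)
    (hf : ContDiff ℝ (⊤ : ℕ∞) f) (hc : HasCompactSupport f)
    (R S : ℝ) (hR : 0 < R) (hRS : R ≤ S) :
    (2 * S) ^ d * ∫ x in boxSet d R, f x ^ 2 ≤
      2 * (2 * R) ^ d * (∫ x in boxSet d S, f x ^ 2) +
      2 * (d * (2 * S)) ^ ((d:ℝ) + α) * fracD d α f := by
  have hS : 0 < S := hR.trans_le hRS
  have hf2 : Integrable (fun y => f y ^ 2) := by
    simpa [sq] using cc_sq_integrable d f f hf.continuous hf.continuous hc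
  have hfin : ∀ R, volume (boxSet d R) < ⊤ := fun R => by
    rw [boxSet, cubeSet_volume]; exact ENNReal.pow_lt_top ENNReal.ofReal_lt_top
  have hconst : ∀ (R c : ℝ), Integrable (fun _ : EuclideanSpace ℝ (Fin d) => c)
      (volume.restrict (boxSet d R)) := fun R c => integrableOn_const (hfin R).ne
  have hG := G_integrable d α hα hd f hf hc
  set IS := ∫ x in boxSet d S, f x ^ 2 with hIS
  set A := (d * (2 * S)) ^ ((d:ℝ) + α) with hA
  have hA0 : 0 ≤ A := by positivity
  have pt : ∀ x ∈ boxSet d R, (2 * S) ^ d * f x ^ 2 ≤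
      2 * IS + 2 * A * ∫ y, kerD d α f (x, y) := by
    intro x hx
    have h := cube_ptwise d α hα hd f hf hc (fun _ => -S) (2 * S) (by positivity) x
      (boxSet_mono d hRS hx)
    have hSint : IntegrableOn (fun y => (f x - f y) ^ 2) (boxSet d S) := by
      have : (fun y => (f x - f y) ^ 2) = fun y => (f x ^ 2 - 2 * f x * f y) + f y ^ 2 := by
        ext y; ring
      rw [this]
      exact Integrable.add (Integrable.sub (hconst S _)
        ((hf.continuous.integrable_of_hasCompactSupport hc).const_mul _).integrableOn)
        hf2.integrableOn
    have h2 : ∫ y in boxSet d S, f x ^ 2 ≤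
        ∫ y in boxSet d S, (2 * f y ^ 2 + 2 * (f x - f y) ^ 2) := by
      apply integral_mono (hconst S _)
      · exact Integrable.add (hf2.integrableOn.const_mul _) (hSint.const_mul _)
      · intro y
        dsimp only
        nlinarith [sq_nonneg (f x - 2 * f y)]
    rw [integral_add (hf2.integrableOn.const_mul _) (hSint.const_mul _), integral_const_mul,
      integral_const_mul, setIntegral_const, boxSet,
      cubeSet_volume_real d _ _ (by positivity : 0 ≤ 2 * S), smul_eq_mul] at h2
    rw [← boxSet] at h h2
    rw [← hIS] at h2
    linarith
  have hR' : volume.real (boxSet d R) = (2 * R) ^ d :=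
    cubeSet_volume_real d _ _ (by positivity)
  calc (2 * S) ^ d * ∫ x in boxSet d R, f x ^ 2
      = ∫ x in boxSet d R, (2 * S) ^ d * f x ^ 2 := (integral_const_mul _ _).symm
    _ ≤ ∫ x in boxSet d R, (2 * IS + 2 * A * ∫ y, kerD d α f (x, y)) := by
        apply setIntegral_mono_on
        · exact (hf2.const_mul _).integrableOn
        · exact Integrable.add (hconst R _) (hG.const_mul _).integrableOn
        · exact cubeSet_measurable ..
        · exact pt
    _ = 2 * (2 * R) ^ d * IS + 2 * A * ∫ x in boxSet d R, ∫ y, kerD d α f (x, y) := by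
        rw [integral_add (hconst R _) (hG.const_mul _).integrableOn,
          setIntegral_const, integral_const_mul, hR', smul_eq_mul]
        ring
    _ ≤ _ := by
        have hle : ∫ x in boxSet d R, ∫ y, kerD d α f (x, y) ≤ fracD d α f := by
          exact setIntegral_le_integral hG
            (Filter.Eventually.of_forall fun x =>
              integral_nonneg fun y => kerD_nonneg d α f (x, y))
        gcongr

lemma box_global (d : ℕ) (α : ℝ) (hα : α ∈ Set.Ioo (0 : ℝ) 2) (hd : α < d) :
    ∃ C : ℝ, 0 < C ∧ ∀ f : EuclideanSpace ℝ (Fin d) → ℝ,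
      ContDiff ℝ (⊤ : ℕ∞) f → HasCompactSupport f → ∀ R : ℝ, 0 < R →
      ∫ x in boxSet d R, f x ^ 2 ≤ C * R ^ α * fracD d α f := by
  have hd1 : 1 ≤ d := by
    by_contra h
    have : d = 0 := by omega
    subst this
    have := hα.1
    norm_num at hd; linarith
  have hα0 := hα.1
  set M : ℝ := (4:ℝ) ^ (((d:ℝ) - α)⁻¹) with hM
  have hda : 0 < (d:ℝ) - α := by linarith
  have hM1 : 1 ≤ M := Real.one_le_rpow (by norm_num) (by positivity)
  have hM0 : 0 < M := by linarith
  have hMp : M ^ ((d:ℝ) - α) = 4 := by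
    rw [hM, ← Real.rpow_mul (by norm_num), inv_mul_cancel₀ hda.ne', Real.rpow_one]
  have hMd : M ^ d = 4 * M ^ α := by
    rw [← hMp, ← Real.rpow_add hM0, ← Real.rpow_natCast]; congr 1; ring
  set C0 : ℝ := 2 * (d:ℝ) ^ ((d:ℝ) + α) * (2 * M) ^ α with hC0
  have hC0p : 0 < C0 := by positivity
  refine ⟨2 * C0, by positivity, fun f hf hc => ?_⟩
  have hf2 : Integrable (fun y => f y ^ 2) := by
    simpa [sq] using cc_sq_integrable d f f hf.continuous hf.continuous hc
  have hD := fracD_nonneg d α f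
  set I : ℝ → ℝ := fun R => ∫ x in boxSet d R, f x ^ 2 with hI
  set T := ∫ x, f x ^ 2 with hT
  have hIT : ∀ R, I R ≤ T := fun R =>
    setIntegral_le_integral hf2 (Filter.Eventually.of_forall fun x => sq_nonneg _)
  have step : ∀ R, 0 < R → I R ≤ 1 / 2 * (M ^ α)⁻¹ * I (M * R) + C0 * R ^ α * fracD d α f := by
    intro R hR
    have h := box_step d α hα hd1 f hf hc R (M * R) hR (by nlinarith)
    have e1 : (d * (2 * (M * R))) ^ ((d:ℝ) + α) =
        (2 * (M * R)) ^ d * ((d:ℝ) ^ ((d:ℝ) + α) * (2 * M) ^ α * R ^ α) := by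
      rw [Real.mul_rpow (by positivity) (by positivity),
        Real.rpow_add (x := 2 * (M * R)) (by positivity), Real.rpow_natCast, ← mul_assoc 2 M R,
        Real.mul_rpow (x := 2 * M) (z := α) (by positivity) hR.le]
      ring
    have e2 : 2 * (2 * R) ^ d = (2 * (M * R)) ^ d * (1 / 2 * (M ^ α)⁻¹) := by
      rw [show 2 * (M * R) = M * (2 * R) by ring, mul_pow M, hMd]
      field_simp; norm_num
    have hp : 0 < (2 * (M * R)) ^ d := by positivity
    rw [e1, e2] at h
    refine le_of_mul_le_mul_left (h.trans (le_of_eq ?_)) hp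
    rw [hC0]; ring
  have iter : ∀ j : ℕ, ∀ R, 0 < R →
      I R ≤ (1 / 2) ^ j * T + 2 * C0 * R ^ α * fracD d α f := by
    intro j
    induction j with
    | zero => 
      intro R hR
      have := hIT R
      have : 0 ≤ 2 * C0 * R ^ α * fracD d α f := by positivity
      simp; linarith
    | succ j ih =>
      intro R hR
      have h1 := step R hR
      have h2 := ih (M * R) (by positivity)
      have hMa : 1 ≤ M ^ α := Real.one_le_rpow hM1 hα0.le
      have hT0 : 0 ≤ T := integral_nonneg fun x => sq_nonneg _
      rw [Real.mul_rpow hM0.le hR.le] at h2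
      have h3 : 1 / 2 * (M ^ α)⁻¹ * I (M * R) ≤ 1 / 2 * (M ^ α)⁻¹ *
          ((1 / 2) ^ j * T + 2 * C0 * (M ^ α * R ^ α) * fracD d α f) := by gcongr
      have h4 : 1 / 2 * (M ^ α)⁻¹ *
          ((1 / 2) ^ j * T + 2 * C0 * (M ^ α * R ^ α) * fracD d α f) =
          (M ^ α)⁻¹ * ((1 / 2) ^ (j + 1) * T) + C0 * R ^ α * fracD d α f := by
        field_simp
        ring
      have h5 : (M ^ α)⁻¹ * ((1 / 2) ^ (j + 1) * T) ≤ 1 * ((1 / 2) ^ (j + 1) * T) := by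
        gcongr
        exact inv_le_one_of_one_le₀ hMa
      linarith
  intro R hR
  have lim : Filter.Tendsto (fun j : ℕ => (1 / 2 : ℝ) ^ j * T + 2 * C0 * R ^ α * fracD d α f)
      Filter.atTop (nhds (0 * T + 2 * C0 * R ^ α * fracD d α f)) :=
    ((tendsto_pow_atTop_nhds_zero_of_lt_one (by norm_num) (by norm_num)).mul_const _).add_const _
  have := ge_of_tendsto' lim fun j => iter j R hR
  simpa using this


lemma grid_bound (d : ℕ) (α : ℝ) (hα : α ∈ Set.Ioo (0 : ℝ) 2) (hd : 1 ≤ d)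
    (f : EuclideanSpace ℝ (Fin d) → ℝ)
    (hf : ContDiff ℝ (⊤ : ℕ∞) f) (hc : HasCompactSupport f) (m : ℕ) (hm : 1 ≤ m)
    (R : ℝ) (hR : 0 < R)
    (h0 : ∀ j : Fin d → Fin m,
      ∫ y in cubeSet d (fun i => -R + (j i : ℕ) * (2 * R / m)) (2 * R / m), f y = 0) :
    ∫ x in boxSet d R, f x ^ 2 ≤ (d:ℝ) ^ ((d:ℝ) + α) * (2 * R / m) ^ α * fracD d α f := by
  have hm0 : (0:ℝ) < m := by exact_mod_cast hm
  set l := 2 * R / m with hl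
  have hlp : 0 < l := by positivity
  have hlm : l * m = 2 * R := by rw [hl]; field_simp
  have hf2 : Integrable (fun y => f y ^ 2) := by
    simpa [sq] using cc_sq_integrable d f f hf.continuous hf.continuous hc
  have hG := G_integrable d α hα hd f hf hc
  have pt : ∀ x ∈ boxSet d R,
      f x ^ 2 ≤ (d:ℝ) ^ ((d:ℝ) + α) * l ^ α * ∫ y, kerD d α f (x, y) := by
    intro x hx
    have hj : ∀ i, ⌊(x i + R) / l⌋₊ < m := by
      intro i
      have := hx i
      simp only at this
      rw [Nat.floor_lt (div_nonneg (by linarith) hlp.le), div_lt_iff₀ hlp]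
      nlinarith
    refine cube_meanzero d α hα hd f hf hc _ l hlp x ?_ (h0 fun i => ⟨_, hj i⟩)
    intro i
    have := hx i
    simp only at this
    have h1 := Nat.floor_le (a := (x i + R) / l) (div_nonneg (by linarith) hlp.le)
    have h2 := Nat.lt_floor_add_one ((x i + R) / l)
    rw [le_div_iff₀ hlp] at h1
    rw [div_lt_iff₀ hlp] at h2
    dsimp only
    constructor <;> nlinarith
  calc ∫ x in boxSet d R, f x ^ 2
      ≤ ∫ x in boxSet d R, (d:ℝ) ^ ((d:ℝ) + α) * l ^ α * ∫ y, kerD d α f (x, y) :=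
        setIntegral_mono_on hf2.integrableOn (hG.const_mul _).integrableOn
          (cubeSet_measurable ..) pt
    _ = (d:ℝ) ^ ((d:ℝ) + α) * l ^ α * ∫ x in boxSet d R, ∫ y, kerD d α f (x, y) :=
        integral_const_mul _ _
    _ ≤ _ := by
        have hle : ∫ x in boxSet d R, ∫ y, kerD d α f (x, y) ≤ fracD d α f := by
          exact setIntegral_le_integral hG
            (Filter.Eventually.of_forall fun x =>
              integral_nonneg fun y => kerD_nonneg d α f (x, y))
        gcongr

lemma exists_box (d : ℕ) (x : EuclideanSpace ℝ (Fin d)) (k : ℕ) (h : ‖x‖ < 2 ^ k) :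
    x ∈ boxSet d (2 ^ k) := by
  intro i
  have h1 : |x i| ≤ ‖x‖ := by simpa using PiLp.norm_apply_le x i
  have := abs_lt.mp (h1.trans_lt h)
  dsimp only
  constructor <;> linarith

lemma norm_of_notMem_box (d : ℕ) (x : EuclideanSpace ℝ (Fin d)) (R : ℝ) (h : x ∉ boxSet d R) :
    R ≤ ‖x‖ := by
  by_contra hlt
  push Not at hlt
  apply h
  intro i
  have h1 : |x i| ≤ ‖x‖ := by simpa using PiLp.norm_apply_le x i
  have := abs_lt.mp (h1.trans_lt hlt)
  dsimp only
  constructor <;> linarith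

lemma W_inv_bound (d : ℕ) (β c₁ : ℝ) (hβ : 0 < β) (hc₁ : 0 < c₁)
    (W : EuclideanSpace ℝ (Fin d) → ℝ)
    (hWlb : ∀ x : EuclideanSpace ℝ (Fin d), c₁ * (1 + ‖x‖) ^ β ≤ W x)
    (x : EuclideanSpace ℝ (Fin d)) (K : ℕ) (hx : x ∈ boxSet d (2 ^ K)) :
    ∃ k ≤ K, x ∈ boxSet d (2 ^ k) ∧ (W x)⁻¹ ≤ c₁⁻¹ * 2 ^ β * (((2:ℝ) ^ β) ^ k)⁻¹ := by
  classical
  have hex : ∃ k, x ∈ boxSet d (2 ^ k) := ⟨K, hx⟩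
  refine ⟨Nat.find hex, Nat.find_min' hex hx, Nat.find_spec hex, ?_⟩
  have hW : 0 < c₁ * (1 + ‖x‖) ^ β := by positivity
  have key : (((2:ℝ) ^ β) ^ (Nat.find hex)) ≤ 2 ^ β * (1 + ‖x‖) ^ β := by
    rcases Nat.eq_zero_or_pos (Nat.find hex) with h | h
    · rw [h, pow_zero]
      have h1 : 1 ≤ (2:ℝ) ^ β := Real.one_le_rpow (by norm_num) hβ.le
      have h2 : 1 ≤ (1 + ‖x‖) ^ β := Real.one_le_rpow (by linarith [norm_nonneg x]) hβ.le
      nlinarith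
    · obtain ⟨k, hk⟩ : ∃ k, Nat.find hex = k + 1 := ⟨Nat.find hex - 1, by omega⟩
      have hn : x ∉ boxSet d (2 ^ k) := Nat.find_min hex (by omega)
      have := norm_of_notMem_box d x _ hn
      rw [hk, pow_succ, Real.rpow_pow_comm (by norm_num), mul_comm]
      gcongr
      linarith
  calc (W x)⁻¹ ≤ (c₁ * (1 + ‖x‖) ^ β)⁻¹ := inv_anti₀ hW (hWlb x)
    _ ≤ _ := by
      rw [mul_assoc, mul_inv]
      gcongr
      rw [← div_eq_mul_inv, inv_le_comm₀ (by positivity) (by positivity), inv_div,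
        div_le_iff₀ (by positivity)]
      linarith

lemma N_integrable (d : ℕ) (β c₁ : ℝ) (hβ : 0 < β) (hc₁ : 0 < c₁)
    (W : EuclideanSpace ℝ (Fin d) → ℝ) (hWmeas : Measurable W)
    (hWlb : ∀ x : EuclideanSpace ℝ (Fin d), c₁ * (1 + ‖x‖) ^ β ≤ W x)
    (f g : EuclideanSpace ℝ (Fin d) → ℝ)
    (hf : Continuous f) (hg : Continuous g) (hc : HasCompactSupport f) :
    Integrable (fun y => f y * g y * (W y)⁻¹) := by
  refine (cc_sq_integrable d f g hf hg hc).mul_bdd (c := c₁⁻¹)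
    hWmeas.inv.aestronglyMeasurable (Filter.Eventually.of_forall fun x => ?_)
  have h2 : 1 ≤ (1 + ‖x‖) ^ β := Real.one_le_rpow (by linarith [norm_nonneg x]) hβ.le
  have h1 : c₁ ≤ W x := le_trans (by nlinarith) (hWlb x)
  rw [Real.norm_of_nonneg (inv_nonneg.mpr (hc₁.le.trans h1))]
  exact inv_anti₀ hc₁ h1

lemma N_bound (d : ℕ) (β c₁ : ℝ) (hβ : 0 < β) (hc₁ : 0 < c₁)
    (W : EuclideanSpace ℝ (Fin d) → ℝ) (hWmeas : Measurable W)
    (hWlb : ∀ x : EuclideanSpace ℝ (Fin d), c₁ * (1 + ‖x‖) ^ β ≤ W x)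
    (f : EuclideanSpace ℝ (Fin d) → ℝ)
    (hf : ContDiff ℝ (⊤ : ℕ∞) f) (hc : HasCompactSupport f) :
    ∃ K : ℕ, ∫ x, f x ^ 2 * (W x)⁻¹ ≤ ∑ k ∈ Finset.range (K + 1),
      c₁⁻¹ * 2 ^ β * (((2:ℝ) ^ β) ^ k)⁻¹ * ∫ x in boxSet d (2 ^ k), f x ^ 2 := by
  have hf2 : Integrable (fun y => f y ^ 2) := by
    simpa [sq] using cc_sq_integrable d f f hf.continuous hf.continuous hc
  obtain ⟨r, hr⟩ := hc.isCompact.isBounded.subset_ball 0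
  obtain ⟨K, hK⟩ := pow_unbounded_of_one_lt r (one_lt_two (α := ℝ))
  refine ⟨K, ?_⟩
  have hWpos : ∀ x, 0 < W x := fun x => lt_of_lt_of_le (by positivity) (hWlb x)
  have e : ∀ k : ℕ, c₁⁻¹ * 2 ^ β * (((2:ℝ) ^ β) ^ k)⁻¹ * ∫ x in boxSet d (2 ^ k), f x ^ 2 =
      ∫ x, c₁⁻¹ * 2 ^ β * (((2:ℝ) ^ β) ^ k)⁻¹ *
        (boxSet d (2 ^ k)).indicator (fun x => f x ^ 2) x := by
    intro k
    rw [integral_const_mul, integral_indicator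
      (show MeasurableSet (boxSet d (2 ^ k)) from cubeSet_measurable ..)]
  have hi : ∀ k : ℕ, Integrable (fun x => c₁⁻¹ * 2 ^ β * (((2:ℝ) ^ β) ^ k)⁻¹ *
        (boxSet d (2 ^ k)).indicator (fun x => f x ^ 2) x) := fun k =>
    (hf2.indicator (cubeSet_measurable ..)).const_mul _
  simp_rw [e]
  rw [← integral_finsetSum _ fun k _ => hi k]
  apply integral_mono
  · simpa [sq] using N_integrable d β c₁ hβ hc₁ W hWmeas hWlb f f hf.continuous hf.continuous hc
  · exact integrable_finsetSum _ fun k _ => hi k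
  · intro x
    have hnn : ∀ k ∈ Finset.range (K + 1), 0 ≤ c₁⁻¹ * 2 ^ β * (((2:ℝ) ^ β) ^ k)⁻¹ *
        (boxSet d (2 ^ k)).indicator (fun x => f x ^ 2) x := fun k _ =>
      mul_nonneg (by positivity) (Set.indicator_nonneg (fun _ _ => sq_nonneg _) _)
    by_cases hx : x ∈ tsupport f
    · have hxb : x ∈ boxSet d (2 ^ K) := exists_box d x K (by
        have := hr hx
        rw [mem_ball_zero_iff] at this
        linarith)
      obtain ⟨k, hk, hxk, hb⟩ := W_inv_bound d β c₁ hβ hc₁ W hWlb x K hxb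
      refine le_trans ?_ (Finset.single_le_sum hnn (Finset.mem_range.mpr (by omega : k < K + 1)))
      rw [Set.indicator_of_mem hxk]
      dsimp only
      rw [mul_comm]
      gcongr
    · dsimp only
      rw [image_eq_zero_of_notMem_tsupport hx]
      simpa using Finset.sum_nonneg hnn

lemma geom_partial (r : ℝ) (h0 : 0 ≤ r) (h1 : r < 1) (K : ℕ) :
    ∑ k ∈ Finset.range K, r ^ k ≤ (1 - r)⁻¹ := by
  rw [← tsum_geometric_of_lt_one h0 h1]
  exact (summable_geometric_of_lt_one h0 h1).sum_le_tsum _ fun k _ => pow_nonneg h0 k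

lemma lower_key (d : ℕ) (α β : ℝ) (hα : α ∈ Set.Ioo (0 : ℝ) 2) (hd : α < d)
    (hβ : α < β) (c₁ : ℝ) (hc₁ : 0 < c₁)
    (W : EuclideanSpace ℝ (Fin d) → ℝ) (hWmeas : Measurable W)
    (hWlb : ∀ x : EuclideanSpace ℝ (Fin d), c₁ * (1 + ‖x‖) ^ β ≤ W x) :
    ∃ C : ℝ, 0 < C ∧ ∀ n : ℕ, 1 ≤ n → ∀ F : Submodule ℝ (EuclideanSpace ℝ (Fin d) → ℝ),
    Module.finrank ℝ F = n →
    (∀ f ∈ F, ContDiff ℝ (⊤ : ℕ∞) f ∧ HasCompactSupport f) →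
    ∃ f ∈ F, f ≠ 0 ∧
      (n : ℝ) ^ (α / (d:ℝ)) * ∫ x, f x ^ 2 * (W x)⁻¹ ≤ C * fracD d α f := by
  have hα0 := hα.1
  have hd0 : (0:ℝ) < d := hα0.trans hd
  have hd1 : 1 ≤ d := by exact_mod_cast hd0
  have hβ0 : 0 < β := hα0.trans hβ
  obtain ⟨C1, hC1, hglob⟩ := box_global d α hα hd
  set η := (β - α) / (2 * α) with hη
  have hη0 : 0 < η := div_pos (by linarith) (by linarith)
  set s : ℝ := 2 ^ (-η) with hs
  have hs0 : 0 < s := by positivity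
  have hs1 : s < 1 := Real.rpow_lt_one_of_one_lt_of_neg (by norm_num) (by linarith)
  set ε : ℝ := (1 - s) / 2 with hε
  have hε0 : 0 < ε := by rw [hε]; linarith
  have hε1 : ε ≤ 1 := by rw [hε]; linarith
  set r : ℝ := ((2:ℝ) ^ β)⁻¹ * (2 / s) ^ α with hr
  have hr0 : 0 ≤ r := by positivity
  have hr1 : r < 1 := by
    have : r = 2 ^ (-((β - α) / 2)) := by
      rw [hr, hs, ← Real.rpow_neg (by norm_num), Real.rpow_neg (x := 2) (y := η) (by norm_num),
        div_inv_eq_mul]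
      nth_rewrite 2 [← Real.rpow_one (2:ℝ)]
      rw [← Real.rpow_add (by norm_num), ← Real.rpow_mul (by norm_num),
        ← Real.rpow_add (by norm_num)]
      congr 1
      rw [hη]
      field_simp
      ring
    rw [this]
    exact Real.rpow_lt_one_of_one_lt_of_neg (by norm_num) (by linarith)
  set C2 : ℝ := max C1 ((d:ℝ) ^ ((d:ℝ) + α) * 4 ^ α) with hC2
  have hC2p : 0 < C2 := lt_of_lt_of_le hC1 (le_max_left _ _)
  refine ⟨c₁⁻¹ * 2 ^ β * (C2 * (ε ^ α)⁻¹) * (1 - r)⁻¹, ?_, ?_⟩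
  · have : 0 < 1 - r := by linarith
    positivity
  intro n hn F hF hFc
  have hn0 : (0:ℝ) < n := by exact_mod_cast hn
  set ν : ℝ := (n:ℝ) ^ ((d:ℝ)⁻¹) with hν
  have hν0 : 0 < ν := by positivity
  have hνd : ν ^ d = n := Real.rpow_inv_natCast_pow hn0.le (by omega)
  set t : ℕ → ℝ := fun k => ε * ν * s ^ k with ht
  have ht0 : ∀ k, 0 < t k := fun k => by simp only [ht]; positivity
  set m : ℕ → ℕ := fun k => ⌊t k⌋₊ with hm
  have hmt : ∀ k, (m k : ℝ) ≤ t k := fun k => Nat.floor_le (ht0 k).le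
  obtain ⟨K, hK⟩ : ∃ K : ℕ, ∀ k, K ≤ k → m k = 0 := by
    obtain ⟨K, hK⟩ := exists_pow_lt_of_lt_one (by positivity : 0 < (ε * ν)⁻¹) hs1
    refine ⟨K, fun k hk => Nat.floor_eq_zero.mpr ?_⟩
    have h1 : s ^ k ≤ s ^ K := pow_le_pow_of_le_one hs0.le hs1.le hk
    calc ε * ν * s ^ k < ε * ν * (ε * ν)⁻¹ := by gcongr; exact h1.trans_lt hK
      _ = 1 := mul_inv_cancel₀ (by positivity)
  -- the constraints
  let T : F →ₗ[ℝ] ((k : Fin K) × (Fin d → Fin (m k)) → ℝ) :=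
    { toFun := fun f p => ∫ y in cubeSet d
        (fun i => -(2 ^ (p.1 : ℕ)) + (p.2 i : ℕ) * (2 * 2 ^ (p.1 : ℕ) / m p.1))
        (2 * 2 ^ (p.1 : ℕ) / m p.1), (f : EuclideanSpace ℝ (Fin d) → ℝ) y
      map_add' := by
        intro f g
        ext p
        have h1 := hFc f f.2
        have h2 := hFc g g.2
        exact integral_add (h1.1.continuous.integrable_of_hasCompactSupport h1.2).integrableOn
          (h2.1.continuous.integrable_of_hasCompactSupport h2.2).integrableOn
      map_smul' := by
        intro c f
        ext p
        exact integral_const_mul _ _ }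
  have hfd : FiniteDimensional ℝ F := Module.finite_of_finrank_pos (by omega)
  have hcard : Module.finrank ℝ ((k : Fin K) × (Fin d → Fin (m k)) → ℝ) <
      Module.finrank ℝ F := by
    rw [hF, Module.finrank_fintype_fun_eq_card, Fintype.card_sigma]
    simp only [Fintype.card_pi, Fintype.card_fin, Finset.prod_const, Finset.card_univ]
    rw [Fin.sum_univ_eq_sum_range (fun k => m k ^ d)]
    have hlt : (∑ k ∈ Finset.range K, (m k : ℝ) ^ d) < n := by
      calc (∑ k ∈ Finset.range K, (m k : ℝ) ^ d) ≤ ∑ k ∈ Finset.range K, ε * n * s ^ k := by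
            apply Finset.sum_le_sum
            intro k _
            calc (m k : ℝ) ^ d ≤ (t k) ^ d := by gcongr; exact hmt k
              _ = ε ^ d * n * (s ^ k) ^ d := by simp only [ht]; rw [mul_pow, mul_pow, hνd]
              _ ≤ ε * n * s ^ k := by
                gcongr
                · exact pow_le_of_le_one hε0.le hε1 (by omega)
                · exact pow_le_of_le_one (by positivity) (pow_le_one₀ hs0.le hs1.le) (by omega)
        _ = ε * n * ∑ k ∈ Finset.range K, s ^ k := by rw [Finset.mul_sum]
        _ ≤ ε * n * (1 - s)⁻¹ := by
            gcongr
            exact geom_partial s hs0.le hs1 K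
        _ = n / 2 := by
            rw [hε]
            have : 1 - s ≠ 0 := by linarith
            field_simp
        _ < n := by linarith
    exact_mod_cast hlt
  obtain ⟨⟨f, hfF⟩, hfk, hfne⟩ := (Submodule.ne_bot_iff _).mp
    (LinearMap.ker_ne_bot_of_finrank_lt (f := T) hcard)
  obtain ⟨hf, hc⟩ := hFc f hfF
  refine ⟨f, hfF, fun h => hfne (by ext1; exact h), ?_⟩
  have hzero : ∀ (k : ℕ) (hk : k < K) (j : Fin d → Fin (m k)),
      ∫ y in cubeSet d (fun i => -(2 ^ k) + (j i : ℕ) * (2 * 2 ^ k / m k))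
        (2 * 2 ^ k / m k), f y = 0 := by
    intro k hk j
    have := congrFun (LinearMap.mem_ker.mp hfk) ⟨⟨k, hk⟩, j⟩
    exact this
  have hD := fracD_nonneg d α f
  have hbox : ∀ k : ℕ, ∫ x in boxSet d (2 ^ k), f x ^ 2 ≤
      C2 * (2 ^ k / t k) ^ α * fracD d α f := by
    intro k
    have htk := ht0 k
    rcases Nat.eq_zero_or_pos (m k) with h | h
    · have ht1 : t k < 1 := Nat.floor_eq_zero.mp h
      refine (hglob f hf hc (2 ^ k) (by positivity)).trans ?_
      gcongr
      · exact le_max_left _ _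
      · rw [le_div_iff₀ htk]
        have : (0:ℝ) < 2 ^ k := by positivity
        nlinarith
    · have hkK : k < K := by
        by_contra hcon
        have := hK k (by omega)
        omega
      refine (grid_bound d α hα hd1 f hf hc (m k) h (2 ^ k) (by positivity)
        (hzero k hkK)).trans ?_
      have hm1 : (1:ℝ) ≤ m k := by exact_mod_cast h
      have hm2 : t k < m k + 1 := Nat.lt_floor_add_one _
      have : (2 * 2 ^ k / (m k : ℝ)) ^ α ≤ 4 ^ α * (2 ^ k / t k) ^ α := by
        rw [← Real.mul_rpow (by norm_num) (by positivity)]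
        gcongr
        rw [mul_div_assoc', div_le_div_iff₀ (by positivity) htk]
        have : (0:ℝ) < 2 ^ k := by positivity
        nlinarith
      calc (d:ℝ) ^ ((d:ℝ) + α) * (2 * 2 ^ k / (m k : ℝ)) ^ α * fracD d α f
          ≤ (d:ℝ) ^ ((d:ℝ) + α) * (4 ^ α * (2 ^ k / t k) ^ α) * fracD d α f := by gcongr
        _ = ((d:ℝ) ^ ((d:ℝ) + α) * 4 ^ α) * (2 ^ k / t k) ^ α * fracD d α f := by ring
        _ ≤ _ := by gcongr; exact le_max_right _ _
  obtain ⟨J, hJ⟩ := N_bound d β c₁ hβ0 hc₁ W hWmeas hWlb f hf hc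
  have hνα : (n:ℝ) ^ (α / (d:ℝ)) = ν ^ α := by
    rw [hν, ← Real.rpow_mul hn0.le]; congr 1; field_simp
  have hterm : ∀ k, (2 ^ k / t k) ^ α = (ε ^ α)⁻¹ * (ν ^ α)⁻¹ * ((2 / s) ^ α) ^ k := by
    intro k
    simp only [ht]
    rw [show 2 ^ k / (ε * ν * s ^ k) = (ε * ν)⁻¹ * (2 / s) ^ k by
      rw [div_pow]; field_simp, Real.mul_rpow (by positivity) (by positivity),
      Real.inv_rpow (by positivity), Real.mul_rpow hε0.le hν0.le, mul_inv,
      Real.rpow_pow_comm (by positivity)]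
  rw [hνα]
  have hνα0 : 0 < ν ^ α := by positivity
  calc ν ^ α * ∫ x, f x ^ 2 * (W x)⁻¹
      ≤ ν ^ α * ∑ k ∈ Finset.range (J + 1),
        c₁⁻¹ * 2 ^ β * (((2:ℝ) ^ β) ^ k)⁻¹ * (C2 * (2 ^ k / t k) ^ α * fracD d α f) := by
        gcongr
        refine hJ.trans (Finset.sum_le_sum fun k _ => ?_)
        have := hbox k
        gcongr
    _ = c₁⁻¹ * 2 ^ β * (C2 * (ε ^ α)⁻¹) * (∑ k ∈ Finset.range (J + 1), r ^ k) *
          fracD d α f := by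
        rw [Finset.mul_sum, Finset.mul_sum, Finset.sum_mul]
        refine Finset.sum_congr rfl fun k _ => ?_
        rw [hterm, hr, mul_pow, inv_pow]
        field_simp
    _ ≤ _ := by
        gcongr
        exact geom_partial r hr0 hr1 _


lemma N_pos (d : ℕ) (β c₁ : ℝ) (hβ : 0 < β) (hc₁ : 0 < c₁)
    (W : EuclideanSpace ℝ (Fin d) → ℝ) (hWmeas : Measurable W)
    (hWlb : ∀ x : EuclideanSpace ℝ (Fin d), c₁ * (1 + ‖x‖) ^ β ≤ W x)
    (f : EuclideanSpace ℝ (Fin d) → ℝ)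
    (hf : Continuous f) (hc : HasCompactSupport f) (h0 : f ≠ 0) :
    0 < ∫ x, f x ^ 2 * (W x)⁻¹ := by
  have hWpos : ∀ x, 0 < W x := fun x => lt_of_lt_of_le (by positivity) (hWlb x)
  have hi : Integrable (fun x => f x ^ 2 * (W x)⁻¹) := by
    simpa [sq] using N_integrable d β c₁ hβ hc₁ W hWmeas hWlb f f hf hf hc
  rw [integral_pos_iff_support_of_nonneg
    (fun x => mul_nonneg (sq_nonneg _) (inv_nonneg.mpr (hWpos x).le)) hi]
  have : Function.support (fun x => f x ^ 2 * (W x)⁻¹) = Function.support f := by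
    ext x
    simp [(hWpos x).ne']
  rw [this]
  exact hf.isOpen_support.measure_pos _ (Function.support_nonempty_iff.mpr h0)

lemma fracD_le_sum (d : ℕ) (α : ℝ) (hα : α ∈ Set.Ioo (0 : ℝ) 2) (hd : 1 ≤ d)
    {ι : Type*} [Fintype ι] (g : ι → EuclideanSpace ℝ (Fin d) → ℝ) (a : ι → ℝ)
    (hg : ∀ i, ContDiff ℝ (⊤ : ℕ∞) (g i) ∧ HasCompactSupport (g i))
    (f : EuclideanSpace ℝ (Fin d) → ℝ)
    (hf : ContDiff ℝ (⊤ : ℕ∞) f) (hc : HasCompactSupport f) (M : ℝ)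
    (h : ∀ x y, (f x - f y) ^ 2 ≤ M * ∑ i, a i ^ 2 * (g i x - g i y) ^ 2) :
    fracD d α f ≤ M * ∑ i, a i ^ 2 * fracD d α (g i) := by
  have hi := fun i => kerD_integrable d α hα hd (g i) (hg i).1 (hg i).2
  rw [fracD_eq_prod d α hα hd f hf hc]
  have : ∀ i, fracD d α (g i) = _ := fun i => fracD_eq_prod d α hα hd (g i) (hg i).1 (hg i).2
  simp_rw [this, ← integral_const_mul]
  rw [← integral_finsetSum _ fun i _ => (hi i).const_mul _, ← integral_const_mul]
  apply integral_mono (kerD_integrable d α hα hd f hf hc)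
  · exact (integrable_finsetSum _ fun i _ => (hi i).const_mul _).const_mul _
  · intro p
    have h1 := h p.1 p.2
    have h2 : M * ∑ i, a i ^ 2 * kerD d α (g i) p =
        (M * ∑ i, a i ^ 2 * (g i p.1 - g i p.2) ^ 2) / ‖p.1 - p.2‖ ^ ((d:ℝ) + α) := by
      simp only [kerD, mul_div_assoc', Finset.sum_div, Finset.mul_sum]
    dsimp only
    rw [h2]
    unfold kerD
    gcongr

lemma ratio_bdd (d : ℕ) (α β : ℝ) (hα : α ∈ Set.Ioo (0 : ℝ) 2) (hd : 1 ≤ d)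
    (hβ : 0 < β) (c₁ : ℝ) (hc₁ : 0 < c₁)
    (W : EuclideanSpace ℝ (Fin d) → ℝ) (hWmeas : Measurable W)
    (hWlb : ∀ x : EuclideanSpace ℝ (Fin d), c₁ * (1 + ‖x‖) ^ β ≤ W x)
    (F : Submodule ℝ (EuclideanSpace ℝ (Fin d) → ℝ)) [FiniteDimensional ℝ F]
    (hFc : ∀ f ∈ F, ContDiff ℝ (⊤ : ℕ∞) f ∧ HasCompactSupport f) :
    BddAbove { t : ℝ | ∃ f ∈ F, f ≠ 0 ∧
          t = fracD d α f / ∫ x, (f x) ^ 2 * (W x)⁻¹ } := by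
  set N := Module.finrank ℝ F with hN
  let b := Module.finBasis ℝ F
  let g : Fin N → EuclideanSpace ℝ (Fin d) → ℝ := fun i => (b i : EuclideanSpace ℝ (Fin d) → ℝ)
  have hg : ∀ i, ContDiff ℝ (⊤ : ℕ∞) (g i) ∧ HasCompactSupport (g i) := fun i =>
    hFc _ (b i).2
  have hrep : ∀ (f) (hf : f ∈ F) x, f x = ∑ i, b.repr ⟨f, hf⟩ i * g i x := by
    intro f hf x
    have h1 := b.sum_repr ⟨f, hf⟩
    have h2 := congrFun (congrArg (Subtype.val) h1) x
    simp only [Submodule.coe_sum, Finset.sum_apply, Submodule.coe_smul, Pi.smul_apply,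
      smul_eq_mul] at h2
    exact h2.symm
  -- the quadratic form
  let Q : (Fin N → ℝ) → ℝ := fun a => ∑ i, ∑ j, a i * a j * ∫ x, g i x * g j x * (W x)⁻¹
  have hQ : ∀ a : Fin N → ℝ, Q a = ∫ x, (∑ i, a i * g i x) ^ 2 * (W x)⁻¹ := by
    intro a
    have hi : ∀ i j, Integrable (fun x => a i * a j * (g i x * g j x * (W x)⁻¹)) := fun i j =>
      (N_integrable d β c₁ hβ hc₁ W hWmeas hWlb (g i) (g j) (hg i).1.continuous
        (hg j).1.continuous (hg i).2).const_mul _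
    simp only [Q]
    simp_rw [← integral_const_mul]
    have : ∀ i, ∑ j, ∫ x, a i * a j * (g i x * g j x * (W x)⁻¹) =
        ∫ x, ∑ j, a i * a j * (g i x * g j x * (W x)⁻¹) := fun i =>
      (integral_finsetSum _ fun j _ => hi i j).symm
    simp_rw [this]
    rw [← integral_finsetSum _ fun i _ => integrable_finsetSum _ fun j _ => hi i j]
    congr 1
    ext x
    rw [sq, Finset.sum_mul_sum, Finset.sum_mul]
    refine Finset.sum_congr rfl fun i _ => ?_
    rw [Finset.sum_mul]
    refine Finset.sum_congr rfl fun j _ => ?_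
    ring
  have hQc : Continuous Q := by fun_prop
  have hQhom : ∀ (c : ℝ) a, Q (c • a) = c ^ 2 * Q a := by
    intro c a
    simp only [Q, Finset.mul_sum, Pi.smul_apply, smul_eq_mul]
    refine Finset.sum_congr rfl fun i _ => Finset.sum_congr rfl fun j _ => ?_
    ring
  have hQpos : ∀ a, a ≠ 0 → 0 < Q a := by
    intro a ha
    rw [hQ]
    have hmem : ((∑ i, a i • b i : F) : EuclideanSpace ℝ (Fin d) → ℝ) ∈ F := Subtype.mem _
    have he : ((∑ i, a i • b i : F) : EuclideanSpace ℝ (Fin d) → ℝ) =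
        fun x => ∑ i, a i * g i x := by
      ext x
      simp [g]
    have hne : ((∑ i, a i • b i : F) : EuclideanSpace ℝ (Fin d) → ℝ) ≠ 0 := by
      intro h
      have h0 : (∑ i, a i • b i : F) = 0 := by ext1; exact h
      exact ha (funext (Fintype.linearIndependent_iff.mp b.linearIndependent a h0))
    rw [he] at hmem hne
    have := hFc _ hmem
    exact N_pos d β c₁ hβ hc₁ W hWmeas hWlb _ this.1.continuous this.2 hne
  obtain ⟨c, hc0, hc⟩ : ∃ c > 0, ∀ a, c * ‖a‖ ^ 2 ≤ Q a := by
    rcases (Metric.sphere (0 : Fin N → ℝ) 1).eq_empty_or_nonempty with he | hne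
    · refine ⟨1, one_pos, fun a => ?_⟩
      have : a = 0 := by
        by_contra ha
        have : ‖a‖⁻¹ • a ∈ Metric.sphere (0 : Fin N → ℝ) 1 := by
          simp [norm_smul, ha]
        rw [he] at this
        exact this
      subst this
      simp [Q]
    · obtain ⟨a0, ha0, hmin⟩ := (isCompact_sphere (0 : Fin N → ℝ) 1).exists_isMinOn hne
        hQc.continuousOn
      have hn0 : a0 ≠ 0 := by
        intro h; rw [h] at ha0; simp at ha0
      refine ⟨Q a0, hQpos a0 hn0, fun a => ?_⟩
      by_cases ha : a = 0
      · subst ha; simp [Q]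
      · have h1 : ‖a‖⁻¹ • a ∈ Metric.sphere (0 : Fin N → ℝ) 1 := by
          simp [norm_smul, ha]
        have h2 : Q a0 ≤ Q (‖a‖⁻¹ • a) := hmin h1
        rw [hQhom] at h2
        have hp : 0 < ‖a‖ := norm_pos_iff.mpr ha
        calc Q a0 * ‖a‖ ^ 2 ≤ (‖a‖⁻¹ ^ 2 * Q a) * ‖a‖ ^ 2 := by gcongr
          _ = Q a := by field_simp
  refine ⟨N * (∑ i, fracD d α (g i)) / c, ?_⟩
  rintro t ⟨f, hfF, hf0, rfl⟩
  obtain ⟨hf, hcs⟩ := hFc f hfF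
  have hr := hrep f hfF
  set a : Fin N → ℝ := fun i => b.repr ⟨f, hfF⟩ i with ha
  have hD : fracD d α f ≤ N * ∑ i, a i ^ 2 * fracD d α (g i) := by
    refine fracD_le_sum d α hα hd g a hg f hf hcs N fun x y => ?_
    have e : f x - f y = ∑ i, a i * (g i x - g i y) := by
      rw [hr x, hr y, ← Finset.sum_sub_distrib]
      exact Finset.sum_congr rfl fun i _ => by simp only [ha]; ring
    rw [e]
    have := sq_sum_le_card_mul_sum_sq (s := Finset.univ) (f := fun i => a i * (g i x - g i y))
    simpa [mul_pow] using this
  have hNf : c * ‖a‖ ^ 2 ≤ ∫ x, f x ^ 2 * (W x)⁻¹ := by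
    refine (hc a).trans (le_of_eq ?_)
    rw [hQ]
    congr 1; ext x; rw [hr x]
  have hpos := N_pos d β c₁ hβ hc₁ W hWmeas hWlb f hf.continuous hcs hf0
  rw [div_le_iff₀ hpos]
  have hS : 0 ≤ ∑ i, fracD d α (g i) := Finset.sum_nonneg fun i _ => fracD_nonneg ..
  calc fracD d α f ≤ N * ∑ i, a i ^ 2 * fracD d α (g i) := hD
    _ ≤ N * ∑ i, ‖a‖ ^ 2 * fracD d α (g i) := by
        refine mul_le_mul_of_nonneg_left (Finset.sum_le_sum fun i _ =>
          mul_le_mul_of_nonneg_right ?_ (fracD_nonneg ..)) (by positivity)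
        rw [← sq_abs]
        have : |a i| ≤ ‖a‖ := by simpa using norm_le_pi_norm a i
        gcongr
    _ = N * (∑ i, fracD d α (g i)) / c * (c * ‖a‖ ^ 2) := by
        rw [← Finset.mul_sum]; field_simp
    _ ≤ _ := by gcongr


lemma scale_integral (d : ℕ) (m : ℝ) (hm : 0 < m) (q : EuclideanSpace ℝ (Fin d))
    (h : EuclideanSpace ℝ (Fin d) → ℝ) :
    ∫ x, h (m • x - q) = (m ^ d)⁻¹ * ∫ x, h x := by
  have := Measure.integral_comp_smul (volume : Measure (EuclideanSpace ℝ (Fin d)))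
    (fun z => h (z - q)) m
  rw [this, integral_sub_right_eq_self h q, finrank_euclideanSpace_fin,
    abs_of_pos (by positivity), smul_eq_mul]

lemma fracD_scale (d : ℕ) (α : ℝ) (m : ℝ) (hm : 0 < m)
    (q : EuclideanSpace ℝ (Fin d)) (φ : EuclideanSpace ℝ (Fin d) → ℝ) :
    fracD d α (fun x => φ (m • x - q)) = m ^ α * (m ^ d)⁻¹ * fracD d α φ := by
  have inner : ∀ x : EuclideanSpace ℝ (Fin d),
      ∫ y, (φ (m • x - q) - φ (m • y - q)) ^ 2 / ‖x - y‖ ^ ((d:ℝ) + α) =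
      m ^ α * ∫ y, (φ (m • x - q) - φ y) ^ 2 / ‖(m • x - q) - y‖ ^ ((d:ℝ) + α) := by
    intro x
    have h1 := scale_integral d m hm q (fun y =>
      ((φ (m • x - q) - φ y) ^ 2 / ‖(m • x - q) - y‖ ^ ((d:ℝ) + α)))
    have hmd : m ^ d ≠ 0 := by positivity
    have hmα : m ^ α ≠ 0 := by positivity
    have h2 : ∀ y, (φ (m • x - q) - φ (m • y - q)) ^ 2 / ‖x - y‖ ^ ((d:ℝ) + α) =
        (m ^ d * m ^ α) * ((φ (m • x - q) - φ (m • y - q)) ^ 2 /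
          ‖(m • x - q) - (m • y - q)‖ ^ ((d:ℝ) + α)) := by
      intro y
      rw [show m • x - q - (m • y - q) = m • (x - y) by rw [smul_sub]; abel, norm_smul,
        Real.norm_of_nonneg hm.le, Real.mul_rpow hm.le (norm_nonneg _), Real.rpow_add hm,
        Real.rpow_natCast, mul_div_assoc', mul_div_mul_left _ _ (by positivity)]
    simp_rw [h2]
    rw [integral_const_mul, h1]
    field_simp
  unfold fracD
  simp_rw [inner]
  rw [integral_const_mul, scale_integral d m hm q
    (fun z => ∫ y, (φ z - φ y) ^ 2 / ‖z - y‖ ^ ((d:ℝ) + α)), mul_assoc]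

lemma upper_key (d : ℕ) (α β δ : ℝ) (hα : α ∈ Set.Ioo (0 : ℝ) 2) (hd : α < d)
    (hβ : α < β) (hδ : 1 < δ)
    (c₁ c₂ c₃ : ℝ) (hc₁ : 0 < c₁) (hc₂ : 0 < c₂) (hc₃ : 0 < c₃)
    (W : EuclideanSpace ℝ (Fin d) → ℝ) (hWmeas : Measurable W)
    (hWlb : ∀ x : EuclideanSpace ℝ (Fin d), c₁ * (1 + ‖x‖) ^ β ≤ W x)
    (hWub : ∀ x : EuclideanSpace ℝ (Fin d),
      W x ≤ c₂ * Real.exp (c₃ * (1 + ‖x‖) ^ ((β - α) / δ))) :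
    ∃ C : ℝ, 0 < C ∧ ∀ n : ℕ, 1 ≤ n → ∃ F : Submodule ℝ (EuclideanSpace ℝ (Fin d) → ℝ),
      Module.finrank ℝ F = n ∧
      (∀ f ∈ F, ContDiff ℝ (⊤ : ℕ∞) f ∧ HasCompactSupport f) ∧
      ∀ f ∈ F, fracD d α f ≤ C * (n:ℝ) ^ (α / (d:ℝ)) * ∫ x, f x ^ 2 * (W x)⁻¹ := by
  have hα0 := hα.1
  have hd0 : (0:ℝ) < d := hα0.trans hd
  have hd1 : 1 ≤ d := by exact_mod_cast hd0
  have hβ0 : 0 < β := hα0.trans hβ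
  have hWpos : ∀ x, 0 < W x := fun x => lt_of_lt_of_le (by positivity) (hWlb x)
  let Φ : ContDiffBump (0 : EuclideanSpace ℝ (Fin d)) := ⟨1/4, 1/2, by norm_num, by norm_num⟩
  let φ : EuclideanSpace ℝ (Fin d) → ℝ := Φ
  have hφs : ContDiff ℝ (⊤ : ℕ∞) φ := Φ.contDiff
  have hφc : HasCompactSupport φ := Φ.hasCompactSupport
  have hφ0 : φ 0 = 1 := Φ.one_of_mem_closedBall (by simp; norm_num [Φ])
  have hφsupp : ∀ z, φ z ≠ 0 → ‖z‖ < 1 / 2 := by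
    intro z hz
    have : z ∈ Function.support Φ := hz
    rw [Φ.support_eq, mem_ball_zero_iff] at this
    exact this
  set I0 := ∫ x, φ x ^ 2 with hI0
  have hI0p : 0 < I0 := by
    have hi : Integrable (fun y => φ y ^ 2) := by
      simpa [sq] using cc_sq_integrable d φ φ hφs.continuous hφs.continuous hφc
    rw [hI0, integral_pos_iff_support_of_nonneg (fun x => sq_nonneg _) hi]
    have : Function.support (fun x => φ x ^ 2) = Function.support φ := by
      ext x; simp
    rw [this]
    refine hφs.continuous.isOpen_support.measure_pos _ ⟨0, ?_⟩
    rw [Function.mem_support, hφ0]; exact one_ne_zero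
  set Wm := c₂ * Real.exp (c₃ * (d + 2) ^ ((β - α) / δ)) with hWm
  have hWmp : 0 < Wm := by positivity
  have hWm' : ∀ x : EuclideanSpace ℝ (Fin d), ‖x‖ ≤ d + 1 → W x ≤ Wm := by
    intro x hx
    refine (hWub x).trans ?_
    have : 0 ≤ (β - α) / δ := div_nonneg (by linarith) (by linarith)
    rw [hWm]
    have h1 : 1 + ‖x‖ ≤ d + 2 := by linarith
    gcongr
  set D0 := fracD d α φ with hD0
  have hD0n : 0 ≤ D0 := fracD_nonneg ..
  refine ⟨2 * 2 ^ α * (D0 + 1) * Wm / I0, by positivity, fun n hn => ?_⟩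
  have hn0 : (0:ℝ) < n := by exact_mod_cast hn
  set ν : ℝ := (n:ℝ) ^ ((d:ℝ)⁻¹) with hν
  have hν1 : 1 ≤ ν := Real.one_le_rpow (by exact_mod_cast hn) (by positivity)
  have hνd : ν ^ d = n := Real.rpow_inv_natCast_pow hn0.le (by omega)
  have hνα : (n:ℝ) ^ (α / (d:ℝ)) = ν ^ α := by
    rw [hν, ← Real.rpow_mul hn0.le]; congr 1; field_simp
  set m : ℕ := ⌈ν⌉₊ with hm
  have hmν : ν ≤ m := Nat.le_ceil _
  have hm2 : (m:ℝ) ≤ 2 * ν := by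
    have := Nat.ceil_lt_add_one (a := ν) (by linarith)
    linarith
  have hm0 : (0:ℝ) < m := by linarith
  have hnm : n ≤ m ^ d := by
    have : (n:ℝ) ≤ (m:ℝ) ^ d := by rw [← hνd]; gcongr
    exact_mod_cast this
  obtain ⟨σ⟩ : Nonempty (Fin n ↪ (Fin d → Fin m)) :=
    Function.Embedding.nonempty_of_card_le (by simpa using hnm)
  let q : Fin n → EuclideanSpace ℝ (Fin d) := fun i => WithLp.toLp 2 fun k => ((σ i k : ℕ) : ℝ)
  have hq : ∀ i, ‖q i‖ ≤ d * m := by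
    intro i
    have h1 : q i ∈ cubeSet d (fun _ => 0) m := by
      intro k
      simp [q]
    have h2 : (0 : EuclideanSpace ℝ (Fin d)) ∈ cubeSet d (fun _ => 0) m := by
      intro k
      simpa using hm0
    simpa using cubeSet_dist d _ m hm0.le _ _ h1 h2
  have hqd : ∀ i j, i ≠ j → 1 ≤ ‖q i - q j‖ := by
    intro i j hij
    have : ∃ k, σ i k ≠ σ j k := by
      by_contra hcon
      push Not at hcon
      exact hij (σ.injective (funext hcon))
    obtain ⟨k, hk⟩ := this
    have h1 : |(q i - q j) k| ≤ ‖q i - q j‖ := by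
      simpa using PiLp.norm_apply_le (q i - q j) k
    refine le_trans ?_ h1
    have hk' : ((σ i k : ℕ) : ℤ) - ((σ j k : ℕ) : ℤ) ≠ 0 := by
      intro h
      apply hk
      ext
      omega
    have := Int.one_le_abs hk'
    simp only [q, PiLp.sub_apply]
    exact_mod_cast this
  let g : Fin n → EuclideanSpace ℝ (Fin d) → ℝ := fun i x => φ ((m:ℝ) • x - q i)
  have hgs : ∀ i, ContDiff ℝ (⊤ : ℕ∞) (g i) := fun i =>
    hφs.comp ((contDiff_const_smul _).sub contDiff_const)
  have hgsupp : ∀ i x, g i x ≠ 0 → ‖(m:ℝ) • x - q i‖ < 1 / 2 := fun i x h => hφsupp _ h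
  have hgball : ∀ i x, g i x ≠ 0 → ‖x‖ ≤ d + 1 := by
    intro i x h
    have h1 := hgsupp i x h
    have h2 : ‖(m:ℝ) • x‖ ≤ ‖(m:ℝ) • x - q i‖ + ‖q i‖ := by
      simpa using norm_add_le ((m:ℝ) • x - q i) (q i)
    rw [norm_smul, Real.norm_of_nonneg hm0.le] at h2
    have h3 := hq i
    have hm1 : (1:ℝ) ≤ m := hν1.trans hmν
    have : m * ‖x‖ ≤ m * (d + 1) := by nlinarith
    exact le_of_mul_le_mul_left this hm0
  have hgc : ∀ i, HasCompactSupport (g i) := fun i =>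
    HasCompactSupport.intro (isCompact_closedBall 0 ((d:ℝ) + 1)) fun x hx => by
      by_contra h
      exact hx (by simpa using hgball i x h)
  have hgdisj : ∀ i j x, g i x ≠ 0 → g j x ≠ 0 → i = j := by
    intro i j x hi hj
    by_contra hij
    have h1 := hgsupp i x hi
    have h2 := hgsupp j x hj
    have h3 := hqd i j hij
    have h4 : ‖q i - q j‖ ≤ ‖(m:ℝ) • x - q j‖ + ‖(m:ℝ) • x - q i‖ := by
      have := norm_sub_le ((m:ℝ) • x - q j) ((m:ℝ) • x - q i)
      simpa using this
    linarith
  have hsq : ∀ (a : Fin n → ℝ) x, (∑ i, a i * g i x) ^ 2 = ∑ i, a i ^ 2 * g i x ^ 2 := by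
    intro a x
    by_cases h : ∃ i, g i x ≠ 0
    · obtain ⟨i, hi⟩ := h
      have h0 : ∀ j, j ≠ i → g j x = 0 := fun j hj => by
        by_contra hcon
        exact hj (hgdisj j i x hcon hi)
      rw [Finset.sum_eq_single i (fun j _ hj => by rw [h0 j hj, mul_zero]) (by simp),
        Finset.sum_eq_single i (fun j _ hj => by rw [h0 j hj]; ring) (by simp)]
      ring
    · push Not at h
      simp [h]
  have hli : LinearIndependent ℝ g := by
    rw [Fintype.linearIndependent_iff]
    intro a ha i
    have h1 := congrFun ha ((m:ℝ)⁻¹ • q i)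
    simp only [Finset.sum_apply, Pi.smul_apply, smul_eq_mul, Pi.zero_apply] at h1
    have h2 := hsq a ((m:ℝ)⁻¹ • q i)
    rw [h1] at h2
    have h3 : a i ^ 2 * g i ((m:ℝ)⁻¹ • q i) ^ 2 ≤ 0 := by
      calc a i ^ 2 * g i ((m:ℝ)⁻¹ • q i) ^ 2 ≤ ∑ i_1, a i_1 ^ 2 * g i_1 ((m:ℝ)⁻¹ • q i) ^ 2 :=
            Finset.single_le_sum (f := fun j => a j ^ 2 * g j ((m:ℝ)⁻¹ • q i) ^ 2)
              (fun j _ => by positivity) (Finset.mem_univ i)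
        _ = 0 := by rw [← h2]; ring
    have h4 : g i ((m:ℝ)⁻¹ • q i) = 1 := by
      simp only [g]
      rw [smul_inv_smul₀ hm0.ne', sub_self, hφ0]
    rw [h4] at h3
    nlinarith [sq_nonneg (a i)]
  have hFc : ∀ f ∈ Submodule.span ℝ (Set.range g),
      ContDiff ℝ (⊤ : ℕ∞) f ∧ HasCompactSupport f := by
    intro f hf
    induction hf using Submodule.span_induction with
    | mem x h => obtain ⟨i, rfl⟩ := h; exact ⟨hgs i, hgc i⟩
    | zero => exact ⟨contDiff_const, HasCompactSupport.zero⟩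
    | add x y _ _ hx hy => exact ⟨hx.1.add hy.1, hx.2.add hy.2⟩
    | smul c x _ hx => exact ⟨contDiff_const.smul hx.1, hx.2.smul_left⟩
  refine ⟨Submodule.span ℝ (Set.range g), ?_, hFc, ?_⟩
  · rw [finrank_span_eq_card hli, Fintype.card_fin]
  intro f hfF
  obtain ⟨hf, hc⟩ := hFc f hfF
  obtain ⟨a, ha⟩ := (Submodule.mem_span_range_iff_exists_fun ℝ).mp hfF
  have hfx : ∀ x, f x = ∑ i, a i * g i x := by
    intro x
    rw [← ha]
    simp
  have hDf : fracD d α f ≤ 2 * ∑ i, a i ^ 2 * fracD d α (g i) := by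
    refine fracD_le_sum d α hα hd1 g a (fun i => ⟨hgs i, hgc i⟩) f hf hc 2 fun x y => ?_
    classical
    have e : f x - f y = ∑ i, a i * (g i x - g i y) := by
      rw [hfx x, hfx y, ← Finset.sum_sub_distrib]
      exact Finset.sum_congr rfl fun i _ => by ring
    set s : Finset (Fin n) := Finset.univ.filter (fun i => g i x ≠ 0) ∪
      Finset.univ.filter (fun i => g i y ≠ 0) with hs
    have hs2 : s.card ≤ 2 := by
      refine (Finset.card_union_le _ _).trans ?_
      have h1 : (Finset.univ.filter (fun i => g i x ≠ 0)).card ≤ 1 :=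
        Finset.card_le_one.mpr fun i hi j hj => hgdisj i j x (by simpa using hi) (by simpa using hj)
      have h2 : (Finset.univ.filter (fun i => g i y ≠ 0)).card ≤ 1 :=
        Finset.card_le_one.mpr fun i hi j hj => hgdisj i j y (by simpa using hi) (by simpa using hj)
      omega
    have hns : ∀ i, i ∉ s → g i x - g i y = 0 := by
      intro i hi
      simp only [hs, Finset.mem_union, Finset.mem_filter, Finset.mem_univ, true_and, not_or,
        not_not] at hi
      rw [hi.1, hi.2, sub_zero]
    have e1 : ∑ i, a i * (g i x - g i y) = ∑ i ∈ s, a i * (g i x - g i y) :=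
      (Finset.sum_subset (Finset.subset_univ s) fun i _ hi => by rw [hns i hi, mul_zero]).symm
    have e2 : ∑ i, a i ^ 2 * (g i x - g i y) ^ 2 = ∑ i ∈ s, (a i * (g i x - g i y)) ^ 2 := by
      rw [← Finset.sum_subset (Finset.subset_univ s) fun i _ hi => by rw [hns i hi]; ring]
      exact Finset.sum_congr rfl fun i _ => by ring
    rw [e, e1, e2]
    refine sq_sum_le_card_mul_sum_sq.trans ?_
    have : (s.card : ℝ) ≤ 2 := by exact_mod_cast hs2
    gcongr
  have hgN : ∀ i, Integrable (fun x => g i x ^ 2 * (W x)⁻¹) := fun i => by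
    simpa [sq] using N_integrable d β c₁ hβ0 hc₁ W hWmeas hWlb (g i) (g i) (hgs i).continuous
      (hgs i).continuous (hgc i)
  have hNf : ∫ x, f x ^ 2 * (W x)⁻¹ = ∑ i, a i ^ 2 * ∫ x, g i x ^ 2 * (W x)⁻¹ := by
    simp_rw [← integral_const_mul]
    rw [← integral_finsetSum _ fun i _ => (hgN i).const_mul _]
    congr 1
    ext x
    rw [hfx x, hsq, Finset.sum_mul]
    exact Finset.sum_congr rfl fun i _ => by ring
  have hgi : ∀ i, Wm⁻¹ * (((m:ℝ) ^ d)⁻¹ * I0) ≤ ∫ x, g i x ^ 2 * (W x)⁻¹ := by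
    intro i
    have h1 := scale_integral d m hm0 (q i) (fun z => φ z ^ 2)
    rw [← h1, ← integral_const_mul]
    have hi2 : Integrable (fun x => g i x ^ 2) := by
      simpa [sq] using cc_sq_integrable d (g i) (g i) (hgs i).continuous (hgs i).continuous (hgc i)
    apply integral_mono (hi2.const_mul _) (hgN i)
    intro x
    change Wm⁻¹ * g i x ^ 2 ≤ g i x ^ 2 * (W x)⁻¹
    by_cases h : g i x = 0
    · simp [h]
    · rw [mul_comm]
      have := hWm' x (hgball i x h)
      have := hWpos x
      gcongr
  have hgD : ∀ i, fracD d α (g i) = (m:ℝ) ^ α * ((m:ℝ) ^ d)⁻¹ * D0 := fun i =>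
    fracD_scale d α m hm0 (q i) φ
  have hS : 0 ≤ ∑ i, a i ^ 2 := Finset.sum_nonneg fun i _ => sq_nonneg _
  rw [hNf, hνα]
  have hmα : (m:ℝ) ^ α ≤ 2 ^ α * ν ^ α := by
    rw [← Real.mul_rpow (by norm_num) (by linarith)]
    gcongr
  calc fracD d α f ≤ 2 * ∑ i, a i ^ 2 * fracD d α (g i) := hDf
    _ = 2 * (m:ℝ) ^ α * ((m:ℝ) ^ d)⁻¹ * D0 * ∑ i, a i ^ 2 := by
        simp_rw [hgD]
        rw [← Finset.sum_mul]; ring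
    _ ≤ 2 * (2 ^ α * ν ^ α) * ((m:ℝ) ^ d)⁻¹ * (D0 + 1) * ∑ i, a i ^ 2 := by
        gcongr
        linarith
    _ = 2 * 2 ^ α * (D0 + 1) * Wm / I0 * ν ^ α *
          ∑ i, a i ^ 2 * (Wm⁻¹ * (((m:ℝ) ^ d)⁻¹ * I0)) := by
        rw [← Finset.sum_mul]
        field_simp
    _ ≤ _ := by
        have : 0 ≤ ν ^ α := by positivity
        gcongr with i
        exact hgi i


theorem eigenvalue_asymptotics
    (d : ℕ) (α β δ : ℝ) (hα : α ∈ Set.Ioo (0 : ℝ) 2) (hd : α < d)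
    (hβ : α < β) (hδ : 1 < δ)
    (c₁ c₂ c₃ : ℝ) (hc₁ : 0 < c₁) (hc₂ : 0 < c₂) (hc₃ : 0 < c₃)
    (W : EuclideanSpace ℝ (Fin d) → ℝ) (hWmeas : Measurable W)
    (hWlb : ∀ x : EuclideanSpace ℝ (Fin d), c₁ * (1 + ‖x‖) ^ β ≤ W x)
    (hWub : ∀ x : EuclideanSpace ℝ (Fin d),
      W x ≤ c₂ * Real.exp (c₃ * (1 + ‖x‖) ^ ((β - α) / δ))) :
    ∃ c : ℝ, 1 ≤ c ∧ ∀ n : ℕ, 1 ≤ n →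
      c⁻¹ * (n : ℝ) ^ (α / (d : ℝ)) ≤ minMaxLevel d α W n ∧
      minMaxLevel d α W n ≤ c * (n : ℝ) ^ (α / (d : ℝ)) := by
  have hα0 := hα.1
  have hd0 : (0:ℝ) < d := hα0.trans hd
  have hd1 : 1 ≤ d := by exact_mod_cast hd0
  have hβ0 : 0 < β := hα0.trans hβ
  obtain ⟨C1, hC1, hlow⟩ := lower_key d α β hα hd hβ c₁ hc₁ W hWmeas hWlb
  obtain ⟨C2, hC2, hup⟩ := upper_key d α β δ hα hd hβ hδ c₁ c₂ c₃ hc₁ hc₂ hc₃ W hWmeas hWlb hWub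
  have hpos := fun f hf hc h0 => N_pos d β c₁ hβ0 hc₁ W hWmeas hWlb f hf hc h0
  set c := max 1 (max C1 C2) with hc
  have hc1 : 1 ≤ c := le_max_left _ _
  have hcC1 : C1 ≤ c := (le_max_left _ _).trans (le_max_right _ _)
  have hcC2 : C2 ≤ c := (le_max_right _ _).trans (le_max_right _ _)
  refine ⟨c, hc1, fun n hn => ?_⟩
  have hnp : 0 < (n:ℝ) ^ (α / (d:ℝ)) := Real.rpow_pos_of_pos (by exact_mod_cast hn) _
  have hge : ∀ Λ ∈ { Λ : ℝ | ∃ F : Submodule ℝ (EuclideanSpace ℝ (Fin d) → ℝ),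
      Module.finrank ℝ F = n ∧
      (∀ f ∈ F, ContDiff ℝ (⊤ : ℕ∞) f ∧ HasCompactSupport f) ∧
      Λ = sSup { t : ℝ | ∃ f ∈ F, f ≠ 0 ∧
          t = fracD d α f / ∫ x, (f x) ^ 2 * (W x)⁻¹ } },
      c⁻¹ * (n : ℝ) ^ (α / (d : ℝ)) ≤ Λ := by
    rintro Λ ⟨F, hF, hFc, rfl⟩
    have hfd : FiniteDimensional ℝ F := Module.finite_of_finrank_pos (by omega)
    obtain ⟨f, hfF, hf0, hle⟩ := hlow n hn F hF hFc
    refine le_trans ?_ (le_csSup (ratio_bdd d α β hα hd1 hβ0 c₁ hc₁ W hWmeas hWlb F hFc)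
      ⟨f, hfF, hf0, rfl⟩)
    rw [le_div_iff₀ (hpos f (hFc f hfF).1.continuous (hFc f hfF).2 hf0), mul_assoc,
      inv_mul_le_iff₀ (by positivity)]
    refine hle.trans ?_
    have := fracD_nonneg d α f
    gcongr
  obtain ⟨F, hF, hFc, hFD⟩ := hup n hn
  have hmem : sSup { t : ℝ | ∃ f ∈ F, f ≠ 0 ∧
          t = fracD d α f / ∫ x, (f x) ^ 2 * (W x)⁻¹ } ∈
      { Λ : ℝ | ∃ F : Submodule ℝ (EuclideanSpace ℝ (Fin d) → ℝ),
      Module.finrank ℝ F = n ∧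
      (∀ f ∈ F, ContDiff ℝ (⊤ : ℕ∞) f ∧ HasCompactSupport f) ∧
      Λ = sSup { t : ℝ | ∃ f ∈ F, f ≠ 0 ∧
          t = fracD d α f / ∫ x, (f x) ^ 2 * (W x)⁻¹ } } := ⟨F, hF, hFc, rfl⟩
  constructor
  · exact le_csInf ⟨_, hmem⟩ hge
  · refine (csInf_le ⟨_, hge⟩ hmem).trans ?_
    refine Real.sSup_le ?_ (by positivity)
    rintro t ⟨f, hfF, hf0, rfl⟩
    have hp := hpos f (hFc f hfF).1.continuous (hFc f hfF).2 hf0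
    rw [div_le_iff₀ hp]
    refine (hFD f hfF).trans ?_
    gcongr
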